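/- arXiv:2511.01798 — 4 statements merged into one kernel-verified Lean document; each statement's English description precedes it below -/
import Mathlib

section
/- Let δ > 0, D_y > 0 and x > 0 be real numbers. Define I_j(x) = ∫₀^{D_y/2} 2·√(x + y²)·arctan( δ / (2·√(x + y²)) ) dy, J₁(x) = ∫₀^{D_y/2} δ·y²/(2·(x + y² + δ²/4)) dy, and J₂(x) = ∫₀^{D_y/2} δ·x·y·ln(y + √(x + y²)) / (2·√(x + y²)·(x + y² + δ²/4)) dy. Then I_j(x) = arctan( δ / (2·√(x + D_y²/4)) ) · ( (D_y/2)·√(x + D_y²/4) + x·ln( D_y/2 + √(x + D_y²/4) ) ) − x·ln(√x)·arctan( δ / (2·√x) ) + J₁(x) + J₂(x). -/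
open Real

lemma hasDerivAt_sqrt_add_sq {x : ℝ} (hx : 0 < x) (y : ℝ) :
    HasDerivAt (fun y => √(x + y ^ 2)) (y / √(x + y ^ 2)) y := by
  have hpos : 0 < x + y ^ 2 := by positivity
  refine (((hasDerivAt_pow 2 y).const_add x).sqrt hpos.ne').congr_deriv ?_
  rw [Nat.cast_ofNat, pow_one, mul_div_mul_left _ _ two_ne_zero]

lemma add_sqrt_add_sq_pos {x : ℝ} (hx : 0 < x) (y : ℝ) : 0 < y + √(x + y ^ 2) := by
  have h : |y| < √(x + y ^ 2) := by
    rw [← sqrt_sq_eq_abs]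
    exact sqrt_lt_sqrt (sq_nonneg y) (by linarith)
  linarith [neg_abs_le y]

lemma hasDerivAt_antideriv_two_mul_sqrt_add_sq {x : ℝ} (hx : 0 < x) (y : ℝ) :
    HasDerivAt (fun y => y * √(x + y ^ 2) + x * log (y + √(x + y ^ 2)))
      (2 * √(x + y ^ 2)) y := by
  have hs := hasDerivAt_sqrt_add_sq hx y
  have hlog := ((hasDerivAt_id y).add hs).log (add_sqrt_add_sq_pos hx y).ne'
  refine (((hasDerivAt_id y).mul hs).add (hlog.const_mul x)).congr_deriv ?_
  have hsq : √(x + y ^ 2) ^ 2 = x + y ^ 2 := sq_sqrt (by positivity)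
  have hs0 : 0 < √(x + y ^ 2) := sqrt_pos.mpr (by positivity)
  have hadd := add_sqrt_add_sq_pos hx y
  simp only [id, Pi.add_apply]
  generalize √(x + y ^ 2) = s at hsq hs0 hadd ⊢
  obtain rfl : x = s ^ 2 - y ^ 2 := by linarith
  field_simp
  ring

lemma hasDerivAt_arctan_div_sqrt_add_sq {x : ℝ} (δ : ℝ) (hx : 0 < x) (y : ℝ) :
    HasDerivAt (fun y => arctan (δ / (2 * √(x + y ^ 2))))
      (-(δ * y / (2 * √(x + y ^ 2) * (x + y ^ 2 + δ ^ 2 / 4)))) y := by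
  have hs0 : 0 < √(x + y ^ 2) := sqrt_pos.mpr (by positivity)
  have hs := (hasDerivAt_sqrt_add_sq hx y).const_mul 2
  refine (((hasDerivAt_const y δ).div hs (by positivity)).arctan).congr_deriv ?_
  have hsq : x + y ^ 2 = √(x + y ^ 2) ^ 2 := (sq_sqrt (by positivity)).symm
  simp only [Pi.div_apply]
  rw [show x + y ^ 2 + δ ^ 2 / 4 = √(x + y ^ 2) ^ 2 + δ ^ 2 / 4 by rw [← hsq]]
  generalize √(x + y ^ 2) = s at hs0 ⊢
  field_simp
  ring

theorem Ij_integration_by_parts (δ Dy x : ℝ) (hδ : 0 < δ) (hDy : 0 < Dy) (hx : 0 < x) :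
    (∫ y in (0:ℝ)..(Dy / 2),
        2 * Real.sqrt (x + y ^ 2) * Real.arctan (δ / (2 * Real.sqrt (x + y ^ 2)))) =
      Real.arctan (δ / (2 * Real.sqrt (x + Dy ^ 2 / 4))) *
          ((Dy / 2) * Real.sqrt (x + Dy ^ 2 / 4) +
            x * Real.log (Dy / 2 + Real.sqrt (x + Dy ^ 2 / 4)))
        - x * Real.log (Real.sqrt x) * Real.arctan (δ / (2 * Real.sqrt x))
        + (∫ y in (0:ℝ)..(Dy / 2), δ * y ^ 2 / (2 * (x + y ^ 2 + δ ^ 2 / 4)))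
        + (∫ y in (0:ℝ)..(Dy / 2),
            δ * x * y * Real.log (y + Real.sqrt (x + y ^ 2)) /
              (2 * Real.sqrt (x + y ^ 2) * (x + y ^ 2 + δ ^ 2 / 4))) := by
  have hs0 : ∀ y : ℝ, 0 < √(x + y ^ 2) := fun y => sqrt_pos.mpr (by positivity)
  have hq : ∀ y : ℝ, 0 < x + y ^ 2 + δ ^ 2 / 4 := fun y => by positivity
  have hden : ∀ y : ℝ, 2 * √(x + y ^ 2) * (x + y ^ 2 + δ ^ 2 / 4) ≠ 0 := fun y =>
    mul_ne_zero (mul_ne_zero two_ne_zero (hs0 y).ne') (hq y).ne'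
  have hlog : Continuous fun y : ℝ => log (y + √(x + y ^ 2)) :=
    Continuous.log (by fun_prop) fun y => (add_sqrt_add_sq_pos hx y).ne'
  have hu' : Continuous fun y : ℝ =>
      -(δ * y / (2 * √(x + y ^ 2) * (x + y ^ 2 + δ ^ 2 / 4))) :=
    (Continuous.div (by fun_prop) (by fun_prop) hden).neg
  have hv' : Continuous fun y : ℝ => 2 * √(x + y ^ 2) := by fun_prop
  have hJ₁ : Continuous fun y : ℝ => δ * y ^ 2 / (2 * (x + y ^ 2 + δ ^ 2 / 4)) :=
    Continuous.div (by fun_prop) (by fun_prop) fun y => mul_ne_zero two_ne_zero (hq y).ne'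
  have hJ₂ : Continuous fun y : ℝ => δ * x * y * log (y + √(x + y ^ 2)) /
      (2 * √(x + y ^ 2) * (x + y ^ 2 + δ ^ 2 / 4)) :=
    Continuous.div (by fun_prop) (by fun_prop) hden
  have hparts := intervalIntegral.integral_mul_deriv_eq_deriv_mul (a := 0) (b := Dy / 2)
    (fun y _ => hasDerivAt_arctan_div_sqrt_add_sq δ hx y)
    (fun y _ => hasDerivAt_antideriv_two_mul_sqrt_add_sq hx y)
    (hu'.intervalIntegrable _ _) (hv'.intervalIntegrable _ _)
  have hsplit : ∀ y : ℝ,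
      -(δ * y / (2 * √(x + y ^ 2) * (x + y ^ 2 + δ ^ 2 / 4))) *
          (y * √(x + y ^ 2) + x * log (y + √(x + y ^ 2))) =
        -(δ * y ^ 2 / (2 * (x + y ^ 2 + δ ^ 2 / 4)) +
          δ * x * y * log (y + √(x + y ^ 2)) /
            (2 * √(x + y ^ 2) * (x + y ^ 2 + δ ^ 2 / 4))) := fun y => by
    have hs := (hs0 y).ne'
    have hq := (hq y).ne'
    generalize x + y ^ 2 + δ ^ 2 / 4 = q at hq ⊢
    generalize √(x + y ^ 2) = s at hs ⊢
    field_simp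
  simp only [hsplit] at hparts
  rw [intervalIntegral.integral_neg, intervalIntegral.integral_add
    (hJ₁.intervalIntegrable _ _) (hJ₂.intervalIntegrable _ _)] at hparts
  simp only [mul_comm (arctan _) (2 * √_)] at hparts
  rw [hparts, show (Dy / 2) ^ 2 = Dy ^ 2 / 4 by ring]
  norm_num only [zero_pow, add_zero, zero_add, zero_mul, ne_eq]
  ring
end

section
/- Let b > 0 and A ≥ 0 be real numbers, and define the inverse-tangent integral Ti₂(z) = ∫₀^{z} arctan(t)/t dt for real z. Then ∫₀^{A} arctan( b·cosh(u) ) du = (π/2)·A + Ti₂( e^{A}·(√(1+b²) − 1)/b ) − Ti₂( (√(1+b²) − 1)/b ) + Ti₂( −e^{A}·(√(1+b²) + 1)/b ) − Ti₂( −(√(1+b²) + 1)/b ). -/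
open Real

/-- The inverse-tangent integral Ti₂(z) = ∫₀^z arctan t / t dt. -/
noncomputable def Ti2 (z : ℝ) : ℝ := ∫ t in (0:ℝ)..z, Real.arctan t / t

theorem continuous_dslope_arctan : Continuous (dslope arctan 0) := by
  rw [← continuousOn_univ, continuousOn_dslope Filter.univ_mem]
  exact ⟨continuous_arctan.continuousOn, differentiable_arctan 0⟩

theorem dslope_arctan_of_ne {t : ℝ} (ht : t ≠ 0) : dslope arctan 0 t = arctan t / t := by
  simp [dslope_of_ne _ ht, slope_def_field]

theorem Ti2_eq_integral_dslope (z : ℝ) : Ti2 z = ∫ t in (0:ℝ)..z, dslope arctan 0 t := by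
  refine intervalIntegral.integral_congr_ae ?_
  filter_upwards [MeasureTheory.Measure.ae_ne MeasureTheory.volume (0 : ℝ)] with t ht _
  rw [dslope_arctan_of_ne ht]

theorem integral_arctan_exp_mul (A : ℝ) {c : ℝ} (hc : c ≠ 0) :
    ∫ u in (0:ℝ)..A, arctan (exp u * c) = Ti2 (exp A * c) - Ti2 c := by
  have hint (x y : ℝ) : IntervalIntegrable (dslope arctan 0) MeasureTheory.volume x y :=
    continuous_dslope_arctan.intervalIntegrable x y
  rw [Ti2_eq_integral_dslope, Ti2_eq_integral_dslope,
    intervalIntegral.integral_interval_sub_left (hint _ _) (hint _ _)]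
  have h := intervalIntegral.integral_comp_mul_deriv (a := 0) (b := A)
    (fun u _ ↦ (hasDerivAt_exp u).mul_const c) (by fun_prop) continuous_dslope_arctan
  rw [exp_zero, one_mul] at h
  rw [← h]
  refine intervalIntegral.integral_congr fun u _ ↦ ?_
  have hu : exp u * c ≠ 0 := mul_ne_zero (exp_ne_zero u) hc
  simp only [Function.comp_apply]
  rw [dslope_arctan_of_ne hu, div_mul_cancel₀ _ hu]

theorem arctan_mul_cosh {b : ℝ} (hb : 0 < b) (u : ℝ) :
    arctan (b * cosh u) = π / 2 + arctan (exp u * ((√(1 + b ^ 2) - 1) / b))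
      + arctan (exp u * (-((√(1 + b ^ 2) + 1) / b))) := by
  have hs : √(1 + b ^ 2) ^ 2 = 1 + b ^ 2 := sq_sqrt (by positivity)
  have hprod : exp u * ((√(1 + b ^ 2) - 1) / b) * (exp u * (-((√(1 + b ^ 2) + 1) / b)))
      = -exp u ^ 2 := by
    field_simp
    linear_combination -hs
  have hsum : exp u * ((√(1 + b ^ 2) - 1) / b) + exp u * (-((√(1 + b ^ 2) + 1) / b))
      = -(2 * exp u / b) := by ring
  have hexp := exp_pos u
  rw [add_assoc, arctan_add (by rw [hprod]; nlinarith), hprod, hsum]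
  have hinv : -(2 * exp u / b) / (1 - -exp u ^ 2) = -(b * cosh u)⁻¹ := by
    rw [cosh_eq, exp_neg, sub_neg_eq_add]
    field_simp
    ring
  rw [hinv, arctan_neg, arctan_inv_of_pos (mul_pos hb (cosh_pos u))]
  ring

theorem arctan_cosh_integral (b A : ℝ) (hb : 0 < b) (hA : 0 ≤ A) :
    (∫ u in (0:ℝ)..A, Real.arctan (b * Real.cosh u)) =
      (Real.pi / 2) * A
        + Ti2 (Real.exp A * (Real.sqrt (1 + b ^ 2) - 1) / b)
        - Ti2 ((Real.sqrt (1 + b ^ 2) - 1) / b)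
        + Ti2 (-(Real.exp A * (Real.sqrt (1 + b ^ 2) + 1) / b))
        - Ti2 (-((Real.sqrt (1 + b ^ 2) + 1) / b)) := by
  have hp : (√(1 + b ^ 2) - 1) / b ≠ 0 := by
    have : 1 < √(1 + b ^ 2) := by
      rw [lt_sqrt zero_le_one]
      nlinarith
    exact div_ne_zero (by linarith) hb.ne'
  have hq : -((√(1 + b ^ 2) + 1) / b) ≠ 0 := neg_ne_zero.mpr (by positivity)
  have hcont (c : ℝ) : Continuous fun u ↦ arctan (exp u * c) := by fun_prop
  simp_rw [arctan_mul_cosh hb]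
  rw [intervalIntegral.integral_add
      (Continuous.intervalIntegrable (by fun_prop) _ _)
      ((hcont _).intervalIntegrable _ _),
    intervalIntegral.integral_add (continuous_const.intervalIntegrable _ _)
      ((hcont _).intervalIntegrable _ _),
    intervalIntegral.integral_const, integral_arctan_exp_mul A hp, integral_arctan_exp_mul A hq,
    mul_neg, mul_div_assoc, mul_div_assoc, smul_eq_mul]
  ring
end

section
/- Let δ > 0, D_y > 0 and x > 0 be real numbers, let A = arsinh( D_y / (2·√x) ), and define the inverse-tangent integral Ti₂(z) = ∫₀^{z} arctan(t)/t dt for real z. Then ∫₀^{D_y/2} δ·x·y·ln(y + √(x + y²)) / (2·√(x + y²)·(x + y² + δ²/4)) dy = x·[ ( ln(√x) + A )·arctan( √(4x + D_y²)/δ ) − ln(√x)·arctan( 2·√x/δ ) − (π/2)·A − Ti₂( e^{A}·(δ/(2·√x))·(√(1 + 4x/δ²) − 1) ) + Ti₂( (δ/(2·√x))·(√(1 + 4x/δ²) − 1) ) − Ti₂( −e^{A}·(δ/(2·√x))·(√(1 + 4x/δ²) + 1) ) + Ti₂( −(δ/(2·√x))·(√(1 + 4x/δ²) + 1) ) ].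 -/
open Real

lemma intervalIntegrable_arctan_div (a b : ℝ) :
    IntervalIntegrable (fun t : ℝ => Real.arctan t / t) MeasureTheory.volume a b := by
  have hc : Continuous (dslope Real.arctan 0) := by
    rw [← continuousOn_univ, continuousOn_dslope Filter.univ_mem]
    exact ⟨Real.continuous_arctan.continuousOn, Real.differentiable_arctan 0⟩
  refine (hc.intervalIntegrable a b).congr_ae ?_
  refine MeasureTheory.ae_restrict_of_ae ?_
  filter_upwards [MeasureTheory.Measure.ae_ne MeasureTheory.volume (0 : ℝ)] with t ht
  rw [dslope_of_ne _ ht, slope_def_field, Real.arctan_zero, sub_zero, sub_zero]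

lemma hasDerivAt_Ti2 {z : ℝ} (hz : z ≠ 0) : HasDerivAt Ti2 (Real.arctan z / z) z :=
  intervalIntegral.integral_hasDerivAt_right (intervalIntegrable_arctan_div 0 z)
    (Measurable.stronglyMeasurable (by fun_prop)).stronglyMeasurableAtFilter
    (Real.continuous_arctan.continuousAt.div continuousAt_id hz)

lemma hasDerivAt_Ti2_mul_exp {c : ℝ} (hc : c ≠ 0) {f : ℝ → ℝ} {f' y : ℝ}
    (hf : HasDerivAt f f' y) :
    HasDerivAt (fun y => Ti2 (c * Real.exp (f y))) (Real.arctan (c * Real.exp (f y)) * f') y := by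
  have h0 : c * Real.exp (f y) ≠ 0 := mul_ne_zero hc (Real.exp_ne_zero _)
  refine ((hasDerivAt_Ti2 h0).comp y (hf.exp.const_mul c)).congr_deriv ?_
  field_simp

lemma arctan_cosh_div {a : ℝ} (ha : 0 < a) (w : ℝ) :
    Real.arctan (Real.cosh w / a) =
      Real.pi / 2 + Real.arctan ((Real.sqrt (a ^ 2 + 1) - a) * Real.exp w)
        + Real.arctan (-(Real.sqrt (a ^ 2 + 1) + a) * Real.exp w) := by
  have hr : Real.sqrt (a ^ 2 + 1) ^ 2 = a ^ 2 + 1 := Real.sq_sqrt (by positivity)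
  have hr0 : a < Real.sqrt (a ^ 2 + 1) := Real.lt_sqrt_of_sq_lt (by linarith)
  set r := Real.sqrt (a ^ 2 + 1)
  have hp : 0 < r - a := sub_pos.mpr hr0
  have hq : 0 < r + a := by linarith
  have hE := Real.exp_pos w
  have hinv : ((r + a) * Real.exp w)⁻¹ = (r - a) * Real.exp (-w) := by
    rw [Real.exp_neg]
    field_simp
    linarith
  have hsum : Real.arctan ((r - a) * Real.exp w) + Real.arctan ((r - a) * Real.exp (-w)) =
      Real.arctan (Real.cosh w / a) := by
    have hprod : (r - a) * Real.exp w * ((r - a) * Real.exp (-w)) = (r - a) ^ 2 := by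
      rw [Real.exp_neg]
      field_simp
    have hsq : 1 - (r - a) ^ 2 = 2 * a * (r - a) := by linarith
    have hpos : 0 < 2 * a * (r - a) := by positivity
    rw [Real.arctan_add (by rw [hprod]; linarith), hprod, hsq, Real.cosh_eq]
    congr 1
    field_simp
  rw [← hsum, ← hinv, Real.arctan_inv_of_pos (by positivity), neg_mul, Real.arctan_neg]
  ring

lemma sqrt_add_sq_eq_mul_cosh {s : ℝ} (hs : 0 < s) (y : ℝ) :
    Real.sqrt (s ^ 2 + y ^ 2) = s * Real.cosh (Real.arsinh (y / s)) := by
  rw [Real.cosh_arsinh, Real.sqrt_eq_iff_eq_sq (by positivity) (by positivity), mul_pow,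
    Real.sq_sqrt (by positivity)]
  field_simp

lemma log_add_sqrt_add_sq {s : ℝ} (hs : 0 < s) (y : ℝ) :
    Real.log (y + Real.sqrt (s ^ 2 + y ^ 2)) = Real.log s + Real.arsinh (y / s) := by
  have h : y + Real.sqrt (s ^ 2 + y ^ 2) = s * Real.exp (Real.arsinh (y / s)) := by
    rw [sqrt_add_sq_eq_mul_cosh hs, ← Real.sinh_add_cosh, Real.sinh_arsinh]
    field_simp
  rw [h, Real.log_mul hs.ne' (Real.exp_ne_zero _), Real.log_exp]

lemma hasDerivAt_arsinh_div {s : ℝ} (hs : 0 < s) (y : ℝ) :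
    HasDerivAt (fun y => Real.arsinh (y / s)) (1 / Real.sqrt (s ^ 2 + y ^ 2)) y := by
  refine (((hasDerivAt_id y).div_const s).arsinh).congr_deriv ?_
  rw [sqrt_add_sq_eq_mul_cosh hs, Real.cosh_arsinh]
  simp [mul_comm]

lemma hasDerivAt_arctan_sqrt_add_sq_div {s d : ℝ} (hs : 0 < s) (hd : 0 < d) (y : ℝ) :
    HasDerivAt (fun y => Real.arctan (Real.sqrt (s ^ 2 + y ^ 2) / d))
      (d * y / (Real.sqrt (s ^ 2 + y ^ 2) * (s ^ 2 + y ^ 2 + d ^ 2))) y := by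
  have hpos : 0 < s ^ 2 + y ^ 2 := by positivity
  have h := ((((hasDerivAt_pow 2 y).const_add (s ^ 2)).sqrt hpos.ne').div_const d).arctan
  refine h.congr_deriv ?_
  have hR : 0 < Real.sqrt (s ^ 2 + y ^ 2) := Real.sqrt_pos.mpr hpos
  rw [div_pow, Real.sq_sqrt hpos.le]
  field_simp
  ring

lemma integral_log_add_sqrt_div {s d : ℝ} (hs : 0 < s) (hd : 0 < d) (b : ℝ) :
    (∫ y in (0:ℝ)..b, d * y * Real.log (y + Real.sqrt (s ^ 2 + y ^ 2)) /
        (Real.sqrt (s ^ 2 + y ^ 2) * (s ^ 2 + y ^ 2 + d ^ 2))) =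
      (Real.log s + Real.arsinh (b / s)) * Real.arctan (Real.sqrt (s ^ 2 + b ^ 2) / d)
        - Real.log s * Real.arctan (s / d)
        - Real.pi / 2 * Real.arsinh (b / s)
        - Ti2 ((Real.sqrt ((d / s) ^ 2 + 1) - d / s) * Real.exp (Real.arsinh (b / s)))
        + Ti2 (Real.sqrt ((d / s) ^ 2 + 1) - d / s)
        - Ti2 (-(Real.sqrt ((d / s) ^ 2 + 1) + d / s) * Real.exp (Real.arsinh (b / s)))
        + Ti2 (-(Real.sqrt ((d / s) ^ 2 + 1) + d / s)) := by
  have ha : 0 < d / s := by positivity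
  have hr0 : d / s < Real.sqrt ((d / s) ^ 2 + 1) := Real.lt_sqrt_of_sq_lt (by linarith)
  have hR : ∀ y : ℝ, 0 < Real.sqrt (s ^ 2 + y ^ 2) := fun y => Real.sqrt_pos.mpr (by positivity)
  have hp : Real.sqrt ((d / s) ^ 2 + 1) - d / s ≠ 0 := (sub_pos.mpr hr0).ne'
  have hq : -(Real.sqrt ((d / s) ^ 2 + 1) + d / s) ≠ 0 := by
    have : 0 < Real.sqrt ((d / s) ^ 2 + 1) + d / s := by positivity
    exact neg_ne_zero.mpr this.ne'
  have hderiv := fun y : ℝ =>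
    (((((hasDerivAt_arsinh_div hs y).const_add (Real.log s)).mul
      (hasDerivAt_arctan_sqrt_add_sq_div hs hd y)).sub
      ((hasDerivAt_arsinh_div hs y).const_mul (Real.pi / 2))).sub
      (hasDerivAt_Ti2_mul_exp hp (hasDerivAt_arsinh_div hs y))).sub
      (hasDerivAt_Ti2_mul_exp hq (hasDerivAt_arsinh_div hs y))
  rw [intervalIntegral.integral_eq_sub_of_hasDerivAt
    (fun y _ => (hderiv y).congr_deriv ?_) ?_]
  · have h0 : Real.sqrt (s ^ 2 + 0 ^ 2) = s := by
      rw [zero_pow two_ne_zero, add_zero, Real.sqrt_sq hs.le]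
    simp only [Pi.sub_apply, Pi.mul_apply, h0, zero_div, Real.arsinh_zero, Real.exp_zero, mul_one]
    ring
  · refine Continuous.intervalIntegrable ?_ 0 b
    simp only [log_add_sqrt_add_sq hs]
    have hcont : Continuous fun y : ℝ => Real.arsinh (y / s) :=
      (continuous_id.div_const s).arsinh
    refine Continuous.div (by fun_prop) (by fun_prop) fun y => ?_
    have := hR y
    positivity
  · have hcosh : Real.sqrt (s ^ 2 + y ^ 2) / d = Real.cosh (Real.arsinh (y / s)) / (d / s) := by
      rw [sqrt_add_sq_eq_mul_cosh hs]
      field_simp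
    rw [log_add_sqrt_add_sq hs, hcosh, arctan_cosh_div ha]
    ring

theorem J2_closed_form (δ Dy x : ℝ) (hδ : 0 < δ) (hDy : 0 < Dy) (hx : 0 < x) :
    (∫ y in (0:ℝ)..(Dy / 2),
        δ * x * y * Real.log (y + Real.sqrt (x + y ^ 2)) /
          (2 * Real.sqrt (x + y ^ 2) * (x + y ^ 2 + δ ^ 2 / 4))) =
      x * ((Real.log (Real.sqrt x) + Real.arsinh (Dy / (2 * Real.sqrt x))) *
            Real.arctan (Real.sqrt (4 * x + Dy ^ 2) / δ)
          - Real.log (Real.sqrt x) * Real.arctan (2 * Real.sqrt x / δ)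
          - (Real.pi / 2) * Real.arsinh (Dy / (2 * Real.sqrt x))
          - Ti2 (Real.exp (Real.arsinh (Dy / (2 * Real.sqrt x))) * (δ / (2 * Real.sqrt x)) *
              (Real.sqrt (1 + 4 * x / δ ^ 2) - 1))
          + Ti2 ((δ / (2 * Real.sqrt x)) * (Real.sqrt (1 + 4 * x / δ ^ 2) - 1))
          - Ti2 (-(Real.exp (Real.arsinh (Dy / (2 * Real.sqrt x))) * (δ / (2 * Real.sqrt x)) *
              (Real.sqrt (1 + 4 * x / δ ^ 2) + 1)))
          + Ti2 (-((δ / (2 * Real.sqrt x)) * (Real.sqrt (1 + 4 * x / δ ^ 2) + 1)))) := by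
  have hs : 0 < Real.sqrt x := Real.sqrt_pos.mpr hx
  have hsq : Real.sqrt x ^ 2 = x := Real.sq_sqrt hx.le
  have hd : 0 < δ / 2 := by positivity
  have hint : ∀ y : ℝ, δ * x * y * Real.log (y + Real.sqrt (x + y ^ 2)) /
        (2 * Real.sqrt (x + y ^ 2) * (x + y ^ 2 + δ ^ 2 / 4)) =
      x * (δ / 2 * y * Real.log (y + Real.sqrt (Real.sqrt x ^ 2 + y ^ 2)) /
        (Real.sqrt (Real.sqrt x ^ 2 + y ^ 2) * (Real.sqrt x ^ 2 + y ^ 2 + (δ / 2) ^ 2))) := by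
    intro y
    rw [hsq]
    have hR : 0 < Real.sqrt (x + y ^ 2) := Real.sqrt_pos.mpr (by positivity)
    field_simp
    ring
  have hA : Dy / 2 / Real.sqrt x = Dy / (2 * Real.sqrt x) := div_div _ _ _
  have ha : δ / 2 / Real.sqrt x = δ / (2 * Real.sqrt x) := div_div _ _ _
  have htop : Real.sqrt (Real.sqrt x ^ 2 + (Dy / 2) ^ 2) / (δ / 2) =
      Real.sqrt (4 * x + Dy ^ 2) / δ := by
    have h4 : 4 * x + Dy ^ 2 = 2 ^ 2 * (Real.sqrt x ^ 2 + (Dy / 2) ^ 2) := by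
      rw [hsq]
      ring
    rw [h4, Real.sqrt_mul (by positivity), Real.sqrt_sq (by positivity)]
    field_simp
  have hbot : Real.sqrt x / (δ / 2) = 2 * Real.sqrt x / δ := by
    field_simp
  have hr : Real.sqrt ((δ / (2 * Real.sqrt x)) ^ 2 + 1) =
      δ / (2 * Real.sqrt x) * Real.sqrt (1 + 4 * x / δ ^ 2) := by
    rw [Real.sqrt_eq_iff_eq_sq (by positivity) (by positivity), mul_pow, Real.sq_sqrt (by positivity), div_pow,
      mul_pow, hsq]
    field_simp
    ring
  simp only [hint, intervalIntegral.integral_const_mul]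
  rw [integral_log_add_sqrt_div hs hd, hA, ha, htop, hbot, hr]
  ring_nf
end

section
/- Let δ > 0, D_y > 0, h > 0 and C > 0 be real numbers. Define, for x > 0, I_i(x) = ∫₀^{D_y/2} (δ/2)·ln(δ²/4 + x + y²) dy and I_j(x) = ∫₀^{D_y/2} 2·√(x + y²)·arctan( δ / (2·√(x + y²)) ) dy. Then ∫₀^{D_y/2} ∫₀^{δ/2} ln( 1 + C/(ε² + y² + h²) ) dε dy = ( I_i(C + h²) + I_j(C + h²) ) − ( I_i(h²) + I_j(h²) ). -/
open Real

theorem integral_log_sq_add_sq {b : ℝ} (hb : 0 < b) (a : ℝ) :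
    ∫ x in (0:ℝ)..a, Real.log (x ^ 2 + b ^ 2) =
      a * Real.log (a ^ 2 + b ^ 2) - 2 * a + 2 * b * Real.arctan (a / b) := by
  have hpos : ∀ x : ℝ, x ^ 2 + b ^ 2 ≠ 0 := fun x => by positivity
  have hderiv : ∀ x : ℝ, HasDerivAt
      (fun t => t * Real.log (t ^ 2 + b ^ 2) - 2 * t + 2 * b * Real.arctan (t / b))
      (Real.log (x ^ 2 + b ^ 2)) x := by
    intro x
    have hlog := (((hasDerivAt_id' x).pow 2).add_const (b ^ 2)).log (hpos x)
    have harctan := ((hasDerivAt_id' x).div_const b).arctan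
    refine ((((hasDerivAt_id' x).mul hlog).sub ((hasDerivAt_id' x).const_mul 2)).add
      (harctan.const_mul (2 * b))).congr_deriv ?_
    have h1 := hpos x
    have h2 : 1 + (x / b) ^ 2 = (x ^ 2 + b ^ 2) / b ^ 2 := by
      field_simp
      ring
    simp only [h2, Pi.pow_apply]
    field_simp
    ring
  have hcont : Continuous fun x : ℝ => Real.log (x ^ 2 + b ^ 2) :=
    Continuous.log (by fun_prop) hpos
  rw [intervalIntegral.integral_eq_sub_of_hasDerivAt (fun x _ => hderiv x)
    (hcont.intervalIntegrable _ _)]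
  simp

theorem integral_log_add_const {δ x : ℝ} (hx : 0 < x) (y : ℝ) :
    ∫ ε in (0:ℝ)..(δ / 2), Real.log (ε ^ 2 + (x + y ^ 2)) =
      (δ / 2) * Real.log (δ ^ 2 / 4 + x + y ^ 2) - δ +
        2 * Real.sqrt (x + y ^ 2) * Real.arctan (δ / (2 * Real.sqrt (x + y ^ 2))) := by
  have hpos : 0 < x + y ^ 2 := by positivity
  have key := integral_log_sq_add_sq (Real.sqrt_pos.2 hpos) (δ / 2)
  rw [Real.sq_sqrt hpos.le] at key
  rw [key, div_div, show (δ / 2) ^ 2 + (x + y ^ 2) = δ ^ 2 / 4 + x + y ^ 2 by ring]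
  ring

theorem integral_log_one_add_div {δ C h : ℝ} (hh : 0 < h) (hC : 0 < C) (y : ℝ) :
    ∫ ε in (0:ℝ)..(δ / 2), Real.log (1 + C / (ε ^ 2 + y ^ 2 + h ^ 2)) =
      ((δ / 2) * Real.log (δ ^ 2 / 4 + (C + h ^ 2) + y ^ 2) +
        2 * Real.sqrt ((C + h ^ 2) + y ^ 2) *
          Real.arctan (δ / (2 * Real.sqrt ((C + h ^ 2) + y ^ 2)))) -
      ((δ / 2) * Real.log (δ ^ 2 / 4 + h ^ 2 + y ^ 2) +
        2 * Real.sqrt (h ^ 2 + y ^ 2) *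
          Real.arctan (δ / (2 * Real.sqrt (h ^ 2 + y ^ 2)))) := by
  have hint : ∀ x : ℝ, 0 < x → IntervalIntegrable
      (fun ε : ℝ => Real.log (ε ^ 2 + (x + y ^ 2))) MeasureTheory.volume 0 (δ / 2) :=
    fun x hx => (Continuous.log (by fun_prop) fun ε => by positivity).intervalIntegrable _ _
  have hsplit : ∀ ε : ℝ, Real.log (1 + C / (ε ^ 2 + y ^ 2 + h ^ 2)) =
      Real.log (ε ^ 2 + ((C + h ^ 2) + y ^ 2)) - Real.log (ε ^ 2 + (h ^ 2 + y ^ 2)) := by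
    intro ε
    rw [← Real.log_div (by positivity) (by positivity)]
    congr 1
    field_simp
    ring
  simp only [hsplit]
  rw [intervalIntegral.integral_sub (hint _ (by positivity)) (hint _ (by positivity)),
    integral_log_add_const (by positivity), integral_log_add_const (by positivity)]
  ring

theorem rate_double_integral_decomposition (δ Dy h C : ℝ)
    (hδ : 0 < δ) (hDy : 0 < Dy) (hh : 0 < h) (hC : 0 < C) :
    (∫ y in (0:ℝ)..(Dy / 2), ∫ ε in (0:ℝ)..(δ / 2),
        Real.log (1 + C / (ε ^ 2 + y ^ 2 + h ^ 2))) =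
      ((∫ y in (0:ℝ)..(Dy / 2),
          (δ / 2) * Real.log (δ ^ 2 / 4 + (C + h ^ 2) + y ^ 2)) +
        (∫ y in (0:ℝ)..(Dy / 2),
          2 * Real.sqrt ((C + h ^ 2) + y ^ 2) *
            Real.arctan (δ / (2 * Real.sqrt ((C + h ^ 2) + y ^ 2)))))
      - ((∫ y in (0:ℝ)..(Dy / 2),
          (δ / 2) * Real.log (δ ^ 2 / 4 + h ^ 2 + y ^ 2)) +
        (∫ y in (0:ℝ)..(Dy / 2),
          2 * Real.sqrt (h ^ 2 + y ^ 2) *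
            Real.arctan (δ / (2 * Real.sqrt (h ^ 2 + y ^ 2))))) := by
  have hlog : ∀ x : ℝ, 0 < x → IntervalIntegrable
      (fun y : ℝ => (δ / 2) * Real.log (δ ^ 2 / 4 + x + y ^ 2))
      MeasureTheory.volume 0 (Dy / 2) := fun x hx =>
    (continuous_const.mul
      (Continuous.log (by fun_prop) fun y => by positivity)).intervalIntegrable _ _
  have harctan : ∀ x : ℝ, 0 < x → IntervalIntegrable
      (fun y : ℝ => 2 * Real.sqrt (x + y ^ 2) *
        Real.arctan (δ / (2 * Real.sqrt (x + y ^ 2))))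
      MeasureTheory.volume 0 (Dy / 2) := by
    intro x hx
    have hdiv : Continuous fun y : ℝ => δ / (2 * Real.sqrt (x + y ^ 2)) :=
      continuous_const.div (by fun_prop) fun y => by positivity
    have hsqrt : Continuous fun y : ℝ => 2 * Real.sqrt (x + y ^ 2) := by fun_prop
    exact (hsqrt.mul (Real.continuous_arctan.comp hdiv)).intervalIntegrable _ _
  have hh2 : 0 < h ^ 2 := by positivity
  have hCh : 0 < C + h ^ 2 := by positivity
  simp only [integral_log_one_add_div hh hC]
  rw [← intervalIntegral.integral_add (hlog _ hCh) (harctan _ hCh),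
    ← intervalIntegral.integral_add (hlog _ hh2) (harctan _ hh2),
    ← intervalIntegral.integral_sub ((hlog _ hCh).add (harctan _ hCh))
      ((hlog _ hh2).add (harctan _ hh2))]
end
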